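/- arXiv:1705.02803 — 8 statements merged into one kernel-verified Lean document; each statement's English description precedes it below -/
import Mathlib

section
/- Let ν₁, ν₂, m be positive integers with ν₁ ∣ m and ν₂ ∣ m. Set ν = gcd(ν₁,ν₂), γ₁ = ν₁/ν, γ₂ = ν₂/ν, μ₁ = m/ν₁, μ₂ = m/ν₂. Let ζ ∈ ℂ be a primitive m-th root of unity, let d ∈ ℂ be nonzero, and let j₁, j₂, a be integers. Then there exists t ∈ ℂ with t^{μ₁} = ζ^{μ₁(j₁-1)} d^{μ₁} and t^{μ₂} = ζ^{μ₂(a+j₂-1)} d^{μ₂} if and only if j₁ - j₂ ≡ a (mod ν). -/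
/-- For a primitive `m`-th root of unity `ζ` and `m = ν * μ`, the element `ζ ^ μ` has order `ν`. -/
lemma IsPrimitiveRoot.zpow_mul_eq_zpow_mul_iff {K : Type*} [Field K] {ζ : K} {m ν : ℕ}
    (hζ : IsPrimitiveRoot ζ m) (hm : 0 < m) (hν : ν ∣ m) (k l : ℤ) :
    ζ ^ (((m / ν : ℕ) : ℤ) * k) = ζ ^ (((m / ν : ℕ) : ℤ) * l) ↔ (ν : ℤ) ∣ k - l := by
  have h0 : ζ ≠ 0 := hζ.ne_zero hm.ne'
  have hμ : ((m / ν : ℕ) : ℤ) ≠ 0 :=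
    mod_cast (Nat.div_pos (Nat.le_of_dvd hm hν) (Nat.pos_of_dvd_of_pos hν hm)).ne'
  have hmν : (m : ℤ) = ((m / ν : ℕ) : ℤ) * ν := mod_cast (Nat.div_mul_cancel hν).symm
  rw [← div_eq_one_iff_eq (zpow_ne_zero _ h0), ← zpow_sub₀ h0, hζ.zpow_eq_one_iff_dvd,
    ← mul_sub]
  conv_lhs => rw [hmν]
  exact mul_dvd_mul_iff_left hμ

/-- Solvability of a pair of congruences with not necessarily coprime moduli. -/
lemma Int.exists_dvd_sub_and_dvd_sub_iff (p q : ℕ) (b c : ℤ) :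
    (∃ k : ℤ, (p : ℤ) ∣ k - b ∧ (q : ℤ) ∣ k - c) ↔ ((Nat.gcd p q : ℕ) : ℤ) ∣ c - b := by
  constructor
  · rintro ⟨k, hp, hq⟩
    have hp' := (Int.natCast_dvd_natCast.2 (Nat.gcd_dvd_left p q)).trans hp
    have hq' := (Int.natCast_dvd_natCast.2 (Nat.gcd_dvd_right p q)).trans hq
    simpa using dvd_sub hp' hq'
  · rintro ⟨e, he⟩
    rw [Nat.gcd_eq_gcd_ab] at he
    exact ⟨b + p * (Nat.gcdA p q * e), ⟨Nat.gcdA p q * e, by ring⟩,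
      ⟨-(Nat.gcdB p q * e), by linear_combination -he⟩⟩

/-- Claim 3.1 (arithmetic content): the fiber over an intersection point of two
curve components meets given sheets of the cyclic cover exactly when the stated
congruence holds. -/
theorem stmt_0 (ν₁ ν₂ m : ℕ) (hν₁ : 0 < ν₁) (hν₂ : 0 < ν₂) (hm : 0 < m)
    (hdvd₁ : ν₁ ∣ m) (hdvd₂ : ν₂ ∣ m)
    (ζ : ℂ) (hζ : IsPrimitiveRoot ζ m)
    (d : ℂ) (hd : d ≠ 0) (j₁ j₂ a : ℤ) :
    (∃ t : ℂ,
        t ^ (m / ν₁) = ζ ^ (((m / ν₁ : ℕ) : ℤ) * (j₁ - 1)) * d ^ (m / ν₁) ∧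
        t ^ (m / ν₂) = ζ ^ (((m / ν₂ : ℕ) : ℤ) * (a + j₂ - 1)) * d ^ (m / ν₂)) ↔
      j₁ - j₂ ≡ a [ZMOD (Nat.gcd ν₁ ν₂)] := by
  have h0 : ζ ≠ 0 := hζ.ne_zero hm.ne'
  have key (k l : ℤ) {ν : ℕ} (hν : ν ∣ m) :
      (ζ ^ k * d) ^ (m / ν) = ζ ^ (((m / ν : ℕ) : ℤ) * l) * d ^ (m / ν) ↔ (ν : ℤ) ∣ k - l := by
    rw [← hζ.zpow_mul_eq_zpow_mul_iff hm hν, mul_pow, mul_left_inj' (pow_ne_zero _ hd),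
      ← zpow_natCast, ← zpow_mul, mul_comm k]
  rw [Int.modEq_iff_dvd, show a - (j₁ - j₂) = a + j₂ - 1 - (j₁ - 1) by ring,
    ← Int.exists_dvd_sub_and_dvd_sub_iff]
  constructor
  · rintro ⟨t, h₁, h₂⟩
    have : NeZero m := ⟨hm.ne'⟩
    have hroot : (t / d) ^ m = 1 := by
      have hμ : (t / d) ^ (m / ν₁) = ζ ^ (((m / ν₁ : ℕ) : ℤ) * (j₁ - 1)) := by
        rw [div_pow, h₁, mul_div_cancel_right₀ _ (pow_ne_zero _ hd)]
      have hmν : ((m / ν₁ : ℕ) : ℤ) * ν₁ = m := mod_cast Nat.div_mul_cancel hdvd₁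
      rw [← Nat.div_mul_cancel hdvd₁, pow_mul, hμ, ← zpow_natCast, ← zpow_mul,
        hζ.zpow_eq_one_iff_dvd]
      exact ⟨j₁ - 1, by linear_combination (j₁ - 1) * hmν⟩
    obtain ⟨k, -, hk⟩ := hζ.eq_pow_of_pow_eq_one hroot
    have ht : t = ζ ^ (k : ℤ) * d := by rw [zpow_natCast, hk, div_mul_cancel₀ _ hd]
    rw [ht, key _ _ hdvd₁] at h₁
    rw [ht, key _ _ hdvd₂] at h₂
    exact ⟨k, h₁, h₂⟩
  · rintro ⟨k, h₁, h₂⟩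
    exact ⟨ζ ^ k * d, (key _ _ hdvd₁).2 h₁, (key _ _ hdvd₂).2 h₂⟩
end

section
/- Let ν₁, ν₂, m be positive integers with ν₁ ∣ m and ν₂ ∣ m. Set ν = gcd(ν₁,ν₂), γ₁ = ν₁/ν, γ₂ = ν₂/ν, μ₁ = m/ν₁, μ₂ = m/ν₂. Let ζ ∈ ℂ be a primitive m-th root of unity, let d ∈ ℂ be nonzero, and let j₁, j₂, a be integers. Then there exists t ∈ ℂ with t^{μ₁} = ζ^{μ₁(j₁-1)} d^{μ₁} and t^{μ₂} = ζ^{μ₂(a+j₂-1)} d^{μ₂} if and only if there exist integers β₁, β₂ such that j₁ - j₂ + (β₁γ₁ - β₂γ₂)ν ≡ a (mod m). -/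
/-- The solutions of `t ^ μ = (ζ ^ k * d) ^ μ`, for `ζ` a primitive `ν * μ`-th root of unity. -/
theorem IsPrimitiveRoot.pow_eq_zpow_mul_pow_iff {K : Type*} [Field K] {ν μ : ℕ} {ζ : K}
    (hζ : IsPrimitiveRoot ζ (ν * μ)) (h : 0 < ν * μ) {d : K} (hd : d ≠ 0) (k : ℤ) (t : K) :
    t ^ μ = ζ ^ ((μ : ℤ) * k) * d ^ μ ↔ ∃ β : ℤ, t = ζ ^ (k + β * ν) * d := by
  have hζ0 : ζ ≠ 0 := hζ.ne_zero h.ne'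
  have hμ : NeZero μ := ⟨(Nat.pos_of_mul_pos_left h).ne'⟩
  have hpow : ζ ^ ((μ : ℤ) * k) * d ^ μ = (ζ ^ k * d) ^ μ := by
    rw [mul_pow, mul_comm (μ : ℤ), zpow_mul, zpow_natCast]
  have hne : ζ ^ k * d ≠ 0 := mul_ne_zero (zpow_ne_zero _ hζ0) hd
  rw [hpow]
  constructor
  · intro ht
    have hquot : (t / (ζ ^ k * d)) ^ μ = 1 := by
      rw [div_pow, ht, div_self (pow_ne_zero _ hne)]
    obtain ⟨i, -, hi⟩ := (hζ.pow h rfl).eq_pow_of_pow_eq_one hquot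
    refine ⟨i, ?_⟩
    rw [eq_div_iff hne] at hi
    rw [← hi, zpow_add₀ hζ0, mul_comm (i : ℤ), zpow_mul, zpow_natCast, zpow_natCast]
    ring
  · rintro ⟨β, rfl⟩
    have hone : (ζ ^ (β * (ν : ℤ))) ^ μ = 1 := by
      rw [← zpow_natCast, ← zpow_mul, hζ.zpow_eq_one_iff_dvd]
      exact ⟨β, by push_cast; ring⟩
    rw [zpow_add₀ hζ0, mul_pow, mul_pow, mul_pow, hone, mul_one]

/-- Integer powers of a primitive `m`-th root of unity agree iff the exponents agree mod `m`. -/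
theorem IsPrimitiveRoot.zpow_eq_zpow_iff_intModEq {K : Type*} [Field K] {m : ℕ} {ζ : K}
    (hζ : IsPrimitiveRoot ζ m) (hm : m ≠ 0) (x y : ℤ) :
    ζ ^ x = ζ ^ y ↔ x ≡ y [ZMOD m] := by
  have hζ0 : ζ ≠ 0 := hζ.ne_zero hm
  rw [Int.modEq_comm, Int.modEq_iff_dvd, ← hζ.zpow_eq_one_iff_dvd, zpow_sub₀ hζ0,
    div_eq_one_iff_eq (zpow_ne_zero _ hζ0)]

/-- Intermediate equivalence in the proof of Claim 3.1: solving the two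
simultaneous power equations for `t` amounts to a congruence modulo `m`
involving the Bezout-type expression `β₁γ₁ - β₂γ₂`. -/
theorem stmt_1 (ν₁ ν₂ m : ℕ) (hν₁ : 0 < ν₁) (hν₂ : 0 < ν₂) (hm : 0 < m)
    (hdvd₁ : ν₁ ∣ m) (hdvd₂ : ν₂ ∣ m)
    (ζ : ℂ) (hζ : IsPrimitiveRoot ζ m)
    (d : ℂ) (hd : d ≠ 0) (j₁ j₂ a : ℤ) :
    (∃ t : ℂ,
        t ^ (m / ν₁) = ζ ^ (((m / ν₁ : ℕ) : ℤ) * (j₁ - 1)) * d ^ (m / ν₁) ∧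
        t ^ (m / ν₂) = ζ ^ (((m / ν₂ : ℕ) : ℤ) * (a + j₂ - 1)) * d ^ (m / ν₂)) ↔
      ∃ β₁ β₂ : ℤ,
        j₁ - j₂ + (β₁ * ((ν₁ / Nat.gcd ν₁ ν₂ : ℕ) : ℤ)
            - β₂ * ((ν₂ / Nat.gcd ν₁ ν₂ : ℕ) : ℤ)) * ((Nat.gcd ν₁ ν₂ : ℕ) : ℤ)
          ≡ a [ZMOD m] := by
  have key₁ := IsPrimitiveRoot.pow_eq_zpow_mul_pow_iff (ν := ν₁) (μ := m / ν₁)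
    (by rwa [Nat.mul_div_cancel' hdvd₁]) (by rwa [Nat.mul_div_cancel' hdvd₁]) hd (j₁ - 1)
  have key₂ := IsPrimitiveRoot.pow_eq_zpow_mul_pow_iff (ν := ν₂) (μ := m / ν₂)
    (by rwa [Nat.mul_div_cancel' hdvd₂]) (by rwa [Nat.mul_div_cancel' hdvd₂]) hd (a + j₂ - 1)
  have hg₁ : ((ν₁ / Nat.gcd ν₁ ν₂ : ℕ) : ℤ) * (Nat.gcd ν₁ ν₂ : ℕ) = ν₁ := by
    exact_mod_cast Nat.div_mul_cancel (Nat.gcd_dvd_left ν₁ ν₂)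
  have hg₂ : ((ν₂ / Nat.gcd ν₁ ν₂ : ℕ) : ℤ) * (Nat.gcd ν₁ ν₂ : ℕ) = ν₂ := by
    exact_mod_cast Nat.div_mul_cancel (Nat.gcd_dvd_right ν₁ ν₂)
  have hiff (β₁ β₂ : ℤ) : ζ ^ (j₁ - 1 + β₁ * ν₁) * d = ζ ^ (a + j₂ - 1 + β₂ * ν₂) * d ↔
      j₁ - j₂ + (β₁ * ((ν₁ / Nat.gcd ν₁ ν₂ : ℕ) : ℤ)
        - β₂ * ((ν₂ / Nat.gcd ν₁ ν₂ : ℕ) : ℤ)) * ((Nat.gcd ν₁ ν₂ : ℕ) : ℤ) ≡ a [ZMOD m] := by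
    rw [mul_left_inj' hd, hζ.zpow_eq_zpow_iff_intModEq hm.ne', sub_mul, mul_assoc, mul_assoc,
      hg₁, hg₂, Int.modEq_iff_dvd, Int.modEq_iff_dvd]
    ring_nf
  simp only [key₁, key₂, ← hiff]
  constructor
  · rintro ⟨t, ⟨β₁, h₁⟩, β₂, h₂⟩
    exact ⟨β₁, β₂, h₁.symm.trans h₂⟩
  · rintro ⟨β₁, β₂, h⟩
    exact ⟨_, ⟨β₁, rfl⟩, β₂, h⟩
end

section
/- Let f₁, f₂ be homogeneous polynomials in ℂ[x,y,z] of degrees c₁ ≥ 1 and c₂ ≥ 1 respectively. Assume the intersection is transversal, i.e., for every p ∈ ℂ³ with p ≠ 0 and f₁(p) = f₂(p) = 0, the gradient vectors (∂f₁/∂x(p), ∂f₁/∂y(p), ∂f₁/∂z(p)) and (∂f₂/∂x(p), ∂f₂/∂y(p), ∂f₂/∂z(p)) are linearly independent over ℂ. Then every homogeneous polynomial G ∈ ℂ[x,y,z] satisfying G(p) = 0 for all p ∈ ℂ³ with f₁(p) = f₂(p) = 0 lies in the ideal generated by f₁ and f₂. -/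
open MvPolynomial

namespace MvPolynomial

lemma IsHomogeneous.eval_smul_eq_pow_mul {k σ : Type*} [CommSemiring k] {f : MvPolynomial σ k}
    {c : ℕ} (hf : f.IsHomogeneous c) (t : k) (p : σ → k) :
    eval (t • p) f = t ^ c * eval p f := by
  rw [eval_eq, eval_eq, Finset.mul_sum]
  refine Finset.sum_congr rfl fun d hd => ?_
  have hdeg : ∑ i ∈ d.support, d i = c := by
    simpa [Finsupp.weight_apply, Finsupp.sum] using hf (mem_support_iff.1 hd)
  simp only [Pi.smul_apply, smul_eq_mul, mul_pow, Finset.prod_mul_distrib,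
    Finset.prod_pow_eq_pow_sum, hdeg]
  ring

section Taylor

variable {k σ : Type*} [Field k]

/-- The ideal of the point `p`, generated by the coordinate functions `X i - p i`. -/
noncomputable def pointIdeal (p : σ → k) : Ideal (MvPolynomial σ k) :=
  Ideal.span (Set.range fun i => X i - C (p i))

lemma X_sub_C_mem_pointIdeal (p : σ → k) (i : σ) : X i - C (p i) ∈ pointIdeal p :=
  Ideal.subset_span ⟨i, rfl⟩

lemma eval_eq_zero_of_mem_pointIdeal {p : σ → k} {g : MvPolynomial σ k}
    (hg : g ∈ pointIdeal p) : eval p g = 0 := by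
  have h : pointIdeal p ≤ RingHom.ker (eval p) := by
    rw [pointIdeal, Ideal.span_le]
    rintro _ ⟨i, rfl⟩
    simp [RingHom.mem_ker]
  exact h hg

/-- First order Taylor expansion of a polynomial at a point. -/
lemma sub_taylor_mem_pointIdeal_sq [Fintype σ] (p : σ → k) (g : MvPolynomial σ k) :
    g - C (eval p g) - ∑ i, C (eval p (pderiv i g)) * (X i - C (p i)) ∈ pointIdeal p ^ 2 := by
  classical
  induction g using MvPolynomial.induction_on with
  | C a => simp
  | add f g hf hg =>
    convert add_mem hf hg using 1
    simp only [map_add, add_mul, Finset.sum_add_distrib]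
    ring
  | mul_X f j hf =>
    have hlin : ∑ i, C (eval p (pderiv i f)) * (X i - C (p i)) ∈ pointIdeal p :=
      sum_mem fun i _ => Ideal.mul_mem_left _ _ (X_sub_C_mem_pointIdeal p i)
    have h := add_mem (Ideal.mul_mem_right (X j) _ hf)
      ((pow_two (pointIdeal p)).symm ▸ Ideal.mul_mem_mul hlin (X_sub_C_mem_pointIdeal p j))
    convert h using 1
    have hs : ∑ i, C (eval p (pderiv i (f * X j))) * (X i - C (p i)) =
        C (eval p f) * (X j - C (p j)) +
          C (p j) * ∑ i, C (eval p (pderiv i f)) * (X i - C (p i)) := by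
      simp only [Derivation.leibniz, pderiv_X, smul_eq_mul, map_add, map_mul, eval_X, add_mul,
        Finset.sum_add_distrib, Finset.mul_sum]
      congr 1
      · rw [Finset.sum_eq_single j]
        · simp
        · intro i _ hij
          simp [hij.symm]
        · simp
      · exact Finset.sum_congr rfl fun i _ => by ring
    rw [hs]
    simp only [map_mul, eval_X]
    ring

lemma sub_C_eval_mem_pointIdeal [Fintype σ] (p : σ → k) (g : MvPolynomial σ k) :
    g - C (eval p g) ∈ pointIdeal p := by
  have h := add_mem (Ideal.pow_le_self two_ne_zero (sub_taylor_mem_pointIdeal_sq p g))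
    (sum_mem fun i (_ : i ∈ Finset.univ) => Ideal.mul_mem_left (pointIdeal p)
      (C (eval p (pderiv i g))) (X_sub_C_mem_pointIdeal p i))
  simpa using h

end Taylor

section Local

variable {k σ : Type*} [Field k]

/-- Restriction to the line through the origin and `p`, parametrised so that `p` is at `0`. -/
noncomputable def lineRestrict (p : σ → k) : MvPolynomial σ k →+* Polynomial k :=
  eval₂Hom Polynomial.C fun i => Polynomial.C (p i) * (1 + Polynomial.X)

lemma eval_lineRestrict (p : σ → k) (g : MvPolynomial σ k) (t : k) :
    (lineRestrict p g).eval t = eval ((1 + t) • p) g := by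
  have h : (Polynomial.evalRingHom t).comp (lineRestrict p) = eval ((1 + t) • p) := by
    apply MvPolynomial.ringHom_ext
    · intro a; simp [lineRestrict]
    · intro i; simp [lineRestrict, mul_comm]
  exact congrArg (fun φ => φ g) h

lemma lineRestrict_eq_zero [Infinite k] {p : σ → k} {g : MvPolynomial σ k}
    (h : ∀ t : k, eval (t • p) g = 0) : lineRestrict p g = 0 :=
  Polynomial.funext fun t => by simp [eval_lineRestrict, h]

lemma lineRestrict_mem {p : σ → k} {n : ℕ} {g : MvPolynomial σ k} (hg : g ∈ pointIdeal p ^ n) :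
    Polynomial.X ^ n ∣ lineRestrict p g := by
  have h : (pointIdeal p).map (lineRestrict p) ≤ Ideal.span {Polynomial.X} := by
    rw [pointIdeal, Ideal.map_span, Ideal.span_le]
    rintro _ ⟨_, ⟨i, rfl⟩, rfl⟩
    rw [SetLike.mem_coe, Ideal.mem_span_singleton]
    exact ⟨Polynomial.C (p i), by simp [lineRestrict]; ring⟩
  have h' := Ideal.pow_right_mono h n (Ideal.map_pow (lineRestrict p) _ n ▸
    Ideal.mem_map_of_mem (lineRestrict p) hg)
  rwa [Ideal.span_singleton_pow, Ideal.mem_span_singleton] at h'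

/-- If the ideal `I` of a cone and one coordinate `X i - p i` generate the cotangent space at a
point `p` with `p i ≠ 0`, every polynomial vanishing on the line through `p` lies in `I` locally
at `p`. -/
lemma exists_eval_ne_zero_mul_mem [Infinite k] [Fintype σ] {p : σ → k} {i : σ} (hpi : p i ≠ 0)
    {I : Ideal (MvPolynomial σ k)} (hI : ∀ g ∈ I, ∀ t : k, eval (t • p) g = 0)
    (hgen : pointIdeal p ≤ I ⊔ Ideal.span {X i - C (p i)} ⊔ pointIdeal p ^ 2)
    {G : MvPolynomial σ k} (hG : ∀ t : k, eval (t • p) G = 0) :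
    ∃ s, eval p s ≠ 0 ∧ s * G ∈ I := by
  set M := pointIdeal p
  set h : MvPolynomial σ k := X i - C (p i) with hh
  have hhM : Ideal.span {h} ≤ M :=
    (Ideal.span_singleton_le_iff_mem _).2 (X_sub_C_mem_pointIdeal p i)
  have hpow (n : ℕ) : M ^ n ≤ I ⊔ Ideal.span {h ^ n} ⊔ M ^ (n + 1) := by
    induction n with
    | zero => simp
    | succ n ih =>
      have hn : Ideal.span {h ^ n} * M ^ 2 ≤ M ^ (n + 1 + 1) := by
        rw [← Ideal.span_singleton_pow, add_assoc, pow_add M n 2]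
        exact Ideal.mul_mono_left (Ideal.pow_right_mono hhM n)
      calc M ^ (n + 1) = M ^ n * M := pow_succ _ _
        _ ≤ (I ⊔ Ideal.span {h ^ n} ⊔ M ^ (n + 1)) * M := Ideal.mul_mono_left ih
        _ = I * M ⊔ Ideal.span {h ^ n} * M ⊔ M ^ (n + 1 + 1) := by
          rw [Ideal.sup_mul, Ideal.sup_mul, ← pow_succ]
        _ ≤ I ⊔ Ideal.span {h ^ n} * (I ⊔ Ideal.span {h} ⊔ M ^ 2) ⊔ M ^ (n + 1 + 1) :=
          sup_le_sup_right (sup_le_sup Ideal.mul_le_left (Ideal.mul_mono_right hgen)) _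
        _ = I ⊔ (Ideal.span {h ^ n} * I ⊔ Ideal.span {h ^ (n + 1)} ⊔
              Ideal.span {h ^ n} * M ^ 2) ⊔ M ^ (n + 1 + 1) := by
          rw [Ideal.mul_sup, Ideal.mul_sup, Ideal.span_singleton_mul_span_singleton, ← pow_succ]
        _ ≤ I ⊔ Ideal.span {h ^ (n + 1)} ⊔ M ^ (n + 1 + 1) := by
          have hIle : Ideal.span {h ^ n} * I ≤ I := Ideal.mul_le_right
          exact sup_le (sup_le (le_sup_left.trans le_sup_left)
            (sup_le (sup_le (hIle.trans (le_sup_left.trans le_sup_left))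
              (le_sup_right.trans le_sup_left)) (hn.trans le_sup_right))) le_sup_right
  have hmem (n : ℕ) : G ∈ I ⊔ M ^ n := by
    induction n with
    | zero => simp
    | succ n ih =>
      have h1 := sup_le (le_sup_left.trans le_sup_left) (hpow n) ih
      obtain ⟨y, hy, m, hm, rfl⟩ := Submodule.mem_sup.1 h1
      obtain ⟨a, ha, b, hb, rfl⟩ := Submodule.mem_sup.1 hy
      obtain ⟨c, rfl⟩ := Ideal.mem_span_singleton'.1 hb
      have hcM := sub_C_eval_mem_pointIdeal p c
      have hm' : (c - C (eval p c)) * h ^ n + m ∈ M ^ (n + 1) := by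
        refine add_mem ?_ hm
        rw [pow_succ']
        exact Ideal.mul_mem_mul hcM
          (Ideal.pow_mem_pow (hhM (Ideal.mem_span_singleton_self h)) n)
      have hc0 : eval p c = 0 := by
        have hz := lineRestrict_eq_zero hG
        have hd := lineRestrict_mem hm'
        have e : lineRestrict p ((c - C (eval p c)) * h ^ n + m) =
            - (Polynomial.C (eval p c * p i ^ n) * Polynomial.X ^ n) := by
          have : (c - C (eval p c)) * h ^ n + m = (a + c * h ^ n + m) - a -
            C (eval p c) * h ^ n := by ring
          rw [this, map_sub, map_sub, hz, lineRestrict_eq_zero (hI a ha)]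
          have hl : lineRestrict p h = Polynomial.C (p i) * Polynomial.X := by
            simp [lineRestrict, hh]; ring
          rw [map_mul, map_pow, hl]
          simp [lineRestrict, mul_pow]; ring
        rw [e, dvd_neg, Polynomial.X_pow_dvd_iff] at hd
        have := hd n (Nat.lt_succ_self n)
        rw [Polynomial.coeff_C_mul_X_pow, if_pos rfl] at this
        exact (mul_eq_zero.1 this).resolve_right (pow_ne_zero _ hpi)
      rw [hc0, map_zero, sub_zero] at hm'
      rw [add_assoc]
      exact Submodule.add_mem_sup ha hm'
  have hinf : Ideal.Quotient.mk I G ∈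
      (⨅ n : ℕ, M ^ n • ⊤ : Submodule (MvPolynomial σ k) (MvPolynomial σ k ⧸ I)) := by
    rw [Submodule.mem_iInf]
    intro n
    obtain ⟨a, ha, m, hm, e⟩ := Submodule.mem_sup.1 (hmem n)
    have : Ideal.Quotient.mk I G = m • (1 : MvPolynomial σ k ⧸ I) := by
      rw [← e, map_add, Ideal.Quotient.eq_zero_iff_mem.2 ha, zero_add]
      exact congrArg _ (mul_one m).symm
    rw [this]
    exact Submodule.smul_mem_smul hm trivial
  obtain ⟨⟨r, hr⟩, e⟩ := (Ideal.mem_iInf_smul_pow_eq_bot_iff M _).1 hinf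
  refine ⟨1 - r, by simp [eval_eq_zero_of_mem_pointIdeal hr], ?_⟩
  rw [← Ideal.Quotient.eq_zero_iff_mem, sub_mul, one_mul, map_sub, sub_eq_zero]
  exact e.symm

end Local

section Koszul

variable {k : Type*} [Field k]

lemma isRelPrime_X {σ : Type*} {i j : σ} (hij : i ≠ j) :
    IsRelPrime (X i : MvPolynomial σ k) (X j) := by
  rw [Irreducible.isRelPrime_iff_not_dvd (X_prime).irreducible, X_dvd_X]
  simpa using hij

lemma mem_span_X_pair_of_X_mul_mem {q : MvPolynomial (Fin 3) k}
    (h : X 2 * q ∈ Ideal.span {X 0, X 1}) : q ∈ Ideal.span {X 0, X 1} := by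
  have e : ({X 0, X 1} : Set (MvPolynomial (Fin 3) k)) = X '' {0, 1} := by
    simp [Set.image_pair]
  rw [e, mem_ideal_span_X_image] at h ⊢
  intro m hm
  obtain ⟨i, hi, hne⟩ := h (Finsupp.single 2 1 + m) (by
    rw [mem_support_iff, coeff_X_mul]; exact mem_support_iff.1 hm)
  refine ⟨i, hi, ?_⟩
  rcases hi with rfl | rfl <;> simpa using hne

/-- The homogeneous maximal ideal is not associated to a complete intersection of two surfaces
in affine three-space. -/
lemma mem_span_pair_of_forall_X_mul_mem {f₁ f₂ G : MvPolynomial (Fin 3) k}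
    (hrel : IsRelPrime f₁ f₂) (h : ∀ i, X i * G ∈ Ideal.span {f₁, f₂}) :
    G ∈ Ideal.span {f₁, f₂} := by
  rcases eq_or_ne f₂ 0 with rfl | hf₂
  · rw [isRelPrime_zero_right] at hrel
    rw [Ideal.eq_top_of_isUnit_mem _ (Ideal.subset_span (Set.mem_insert _ _)) hrel]
    trivial
  have syz {i j : Fin 3} {a b a' b' : MvPolynomial (Fin 3) k}
      (e : a * f₁ + b * f₂ = X i * G) (e' : a' * f₁ + b' * f₂ = X j * G) :
      ∃ q, X j * a - X i * a' = q * f₂ ∧ X j * b - X i * b' = - q * f₁ := by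
    have key : (X j * a - X i * a') * f₁ = - (X j * b - X i * b') * f₂ := by
      linear_combination X j * e - X i * e'
    obtain ⟨q, hq⟩ := hrel.symm.dvd_of_dvd_mul_right (Dvd.intro_left _ key.symm)
    refine ⟨q, by rw [hq, mul_comm], mul_right_cancel₀ hf₂ ?_⟩
    rw [hq] at key
    linear_combination key
  obtain ⟨a₀, b₀, e₀⟩ := Ideal.mem_span_pair.1 (h 0)
  obtain ⟨a₁, b₁, e₁⟩ := Ideal.mem_span_pair.1 (h 1)
  obtain ⟨a₂, b₂, e₂⟩ := Ideal.mem_span_pair.1 (h 2)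
  obtain ⟨q, hqa, hqb⟩ := syz e₀ e₁
  obtain ⟨q', hqa', -⟩ := syz e₀ e₂
  obtain ⟨q'', hqa'', -⟩ := syz e₁ e₂
  have hq : X 2 * q = X 1 * q' - X 0 * q'' := mul_right_cancel₀ hf₂ (by
    linear_combination - X 2 * hqa + X 1 * hqa' - X 0 * hqa'')
  obtain ⟨v, u, huv⟩ := Ideal.mem_span_pair.1 (mem_span_X_pair_of_X_mul_mem
    (Ideal.mem_span_pair.2 ⟨-q'', q', by rw [hq]; ring⟩))
  have h01 : IsRelPrime (X 0 : MvPolynomial (Fin 3) k) (X 1) := isRelPrime_X (by decide)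
  obtain ⟨w, hw⟩ : X 0 ∣ a₀ - u * f₂ := h01.dvd_of_dvd_mul_left
    ⟨a₁ + v * f₂, by linear_combination hqa - f₂ * huv⟩
  obtain ⟨w', hw'⟩ : X 0 ∣ b₀ + u * f₁ := h01.dvd_of_dvd_mul_left
    ⟨b₁ - v * f₁, by linear_combination hqb + f₁ * huv⟩
  refine Ideal.mem_span_pair.2 ⟨w, w', mul_left_cancel₀ (X_ne_zero (0 : Fin 3)) ?_⟩
  linear_combination e₀ - f₁ * hw - f₂ * hw'

/-- A polynomial lies in a complete intersection `(f₁, f₂)` in affine three-space as soon as it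
does so locally away from the origin. -/
lemma mem_span_pair_of_locally [IsAlgClosed k] {f₁ f₂ G : MvPolynomial (Fin 3) k}
    (hrel : IsRelPrime f₁ f₂)
    (h : ∀ p : Fin 3 → k, p ≠ 0 → ∃ s, eval p s ≠ 0 ∧ s * G ∈ Ideal.span {f₁, f₂}) :
    G ∈ Ideal.span {f₁, f₂} := by
  set J : Ideal (MvPolynomial (Fin 3) k) := (Ideal.span {f₁, f₂}).colon {G} with hJ
  have memJ {s} : s ∈ J ↔ s * G ∈ Ideal.span {f₁, f₂} := by
    simp [hJ, Submodule.mem_colon_singleton]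
  have hle : Ideal.span (Set.range X) ≤ J.radical := by
    rw [← vanishingIdeal_zeroLocus_eq_radical (K := k), Ideal.span_le]
    rintro _ ⟨i, rfl⟩ p hp
    by_contra hne
    obtain ⟨s, hs, hsG⟩ := h p (by rintro rfl; simp at hne)
    exact hs (by simpa [coe_aeval_eq_eval] using hp s (memJ.2 hsG))
  obtain ⟨n, hn⟩ := Ideal.exists_pow_le_of_le_radical_of_fg hle (IsNoetherian.noetherian _)
  have key (n : ℕ) : Ideal.span (Set.range X) ^ n ≤ J → G ∈ Ideal.span {f₁, f₂} := by
    induction n with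
    | zero => intro h; simpa using memJ.1 (h (by simp : (1 : MvPolynomial (Fin 3) k) ∈ _))
    | succ n ih =>
      refine fun h => ih fun g hg => memJ.2 (mem_span_pair_of_forall_X_mul_mem hrel fun i => ?_)
      rw [← mul_assoc]
      refine memJ.1 (h ?_)
      rw [pow_succ']
      exact Ideal.mul_mem_mul (Ideal.subset_span ⟨i, rfl⟩) hg
  exact key n hn

end Koszul

section Coprime

variable {k σ : Type*} [Field k] [IsAlgClosed k] [Finite σ]

lemma exists_ne_zero_eval_eq_zero [Nontrivial σ] {d : MvPolynomial σ k} (hd : ¬ IsUnit d) :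
    ∃ p : σ → k, p ≠ 0 ∧ eval p d = 0 := by
  by_contra! hp
  have hX (i : σ) : ∃ n : ℕ, d ∣ X i ^ n := by
    have : X i ∈ (Ideal.span {d}).radical := by
      rw [← vanishingIdeal_zeroLocus_eq_radical (K := k)]
      intro p hpd
      by_contra hne
      refine hp p (by rintro rfl; simp at hne) ?_
      simpa [coe_aeval_eq_eval] using hpd d (Ideal.mem_span_singleton_self d)
    obtain ⟨n, hn⟩ := this
    exact ⟨n, Ideal.mem_span_singleton.1 hn⟩
  obtain ⟨i, j, hij⟩ := exists_pair_ne σ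
  obtain ⟨n, hn⟩ := hX i
  obtain ⟨m, hm⟩ := hX j
  exact hd ((isRelPrime_X hij).pow hn hm)

lemma isRelPrime_of_linearIndependent_pderiv [Nontrivial σ] {f₁ f₂ : MvPolynomial σ k}
    (h : ∀ p : σ → k, p ≠ 0 → eval p f₁ = 0 → eval p f₂ = 0 →
      LinearIndependent k ![fun i => eval p (pderiv i f₁), fun i => eval p (pderiv i f₂)]) :
    IsRelPrime f₁ f₂ := by
  rintro d ⟨a, rfl⟩ ⟨b, rfl⟩
  by_contra hd
  obtain ⟨p, hp, hpd⟩ := exists_ne_zero_eval_eq_zero hd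
  have hli := h p hp (by simp [hpd]) (by simp [hpd])
  have e (c : MvPolynomial σ k) : (fun i => eval p (pderiv i (d * c))) =
      eval p c • fun i => eval p (pderiv i d) := by
    ext i; simp [hpd, Derivation.leibniz]
  rw [e, e] at hli
  have h0 := LinearIndependent.pair_iff.1 hli
  have hb := (h0 (eval p b) (- eval p a) (by rw [smul_smul, smul_smul, ← add_smul]; ring_nf; simp))
  have ha : eval p a = 0 := by simpa using hb.2
  simpa [ha] using hli.ne_zero 0

end Coprime

/-- At a transversal intersection point of two cones, their equations and one coordinate generate
the cotangent space. -/
lemma pointIdeal_le_of_linearIndependent {k : Type*} [Field k] {f₁ f₂ : MvPolynomial (Fin 3) k}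
    {c₁ c₂ : ℕ} (hf₁ : f₁.IsHomogeneous c₁) (hf₂ : f₂.IsHomogeneous c₂) {p : Fin 3 → k}
    (h₁ : eval p f₁ = 0) (h₂ : eval p f₂ = 0)
    (hli : LinearIndependent k
      ![fun i => eval p (pderiv i f₁), fun i => eval p (pderiv i f₂)])
    {i : Fin 3} (hpi : p i ≠ 0) :
    pointIdeal p ≤ Ideal.span {f₁, f₂} ⊔ Ideal.span {X i - C (p i)} ⊔ pointIdeal p ^ 2 := by
  have euler {f : MvPolynomial (Fin 3) k} {c : ℕ} (hf : f.IsHomogeneous c) (h : eval p f = 0) :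
      (fun j => eval p (pderiv j f)) ⬝ᵥ p = 0 := by
    have := congrArg (eval p) hf.sum_X_mul_pderiv
    simpa [dotProduct, h, mul_comm] using this
  have hli' : LinearIndependent k (Fin.cons (Pi.single i 1)
      ![fun i => eval p (pderiv i f₁), fun i => eval p (pderiv i f₂)] : Fin 3 → Fin 3 → k) := by
    refine linearIndependent_finCons.2 ⟨hli, fun hmem => hpi ?_⟩
    obtain ⟨c, hc⟩ := (Submodule.mem_span_range_iff_exists_fun k).1 hmem
    have := congrArg (· ⬝ᵥ p) hc
    simpa [add_dotProduct, euler hf₁ h₁, euler hf₂ h₂] using this.symm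
  have htop := hli'.span_eq_top_of_card_eq_finrank (by simp)
  refine Ideal.span_le.2 ?_
  rintro _ ⟨j, rfl⟩
  obtain ⟨c, hc⟩ := (Submodule.mem_span_range_iff_exists_fun k).1
    (htop.ge (Submodule.mem_top (x := (Pi.single j 1 : Fin 3 → k))))
  have t₁ := sub_taylor_mem_pointIdeal_sq p f₁
  have t₂ := sub_taylor_mem_pointIdeal_sq p f₂
  rw [h₁, map_zero, sub_zero] at t₁
  rw [h₂, map_zero, sub_zero] at t₂
  have hlin : X j - C (p j) = C (c 0) * (X i - C (p i)) +
      C (c 1) * ∑ l, C (eval p (pderiv l f₁)) * (X l - C (p l)) +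
      C (c 2) * ∑ l, C (eval p (pderiv l f₂)) * (X l - C (p l)) := by
    have expand (m : Fin 3) : (X m - C (p m) : MvPolynomial (Fin 3) k) =
        ∑ l, C ((Pi.single m 1 : Fin 3 → k) l) * (X l - C (p l)) := by
      rw [Finset.sum_eq_single m]
      · simp
      · intro l _ hl; simp [hl]
      · simp
    rw [expand j, expand i, Finset.mul_sum, Finset.mul_sum, Finset.mul_sum,
      ← Finset.sum_add_distrib, ← Finset.sum_add_distrib]
    refine Finset.sum_congr rfl fun l _ => ?_
    rw [← congrFun hc l]
    simp [Fin.sum_univ_three]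
    ring
  have e : X j - C (p j) = ((C (c 1) * f₁ + C (c 2) * f₂) + C (c 0) * (X i - C (p i))) +
      -(C (c 1) * (f₁ - ∑ l, C (eval p (pderiv l f₁)) * (X l - C (p l))) +
      C (c 2) * (f₂ - ∑ l, C (eval p (pderiv l f₂)) * (X l - C (p l)))) := by
    rw [hlin]; ring
  change X j - C (p j) ∈ _
  rw [e]
  refine Submodule.add_mem_sup (Submodule.add_mem_sup (Ideal.mem_span_pair.2 ⟨_, _, rfl⟩)
    (Ideal.mul_mem_left _ _ (Ideal.mem_span_singleton_self _))) (neg_mem (add_mem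
    (Ideal.mul_mem_left _ _ t₁) (Ideal.mul_mem_left _ _ t₂)))

end MvPolynomial

/-- Key algebraic step in the proof of Corollary 2.5: a homogeneous form
vanishing on the transversal intersection of two plane curves lies in the
ideal generated by their defining forms. -/
theorem stmt_2 (f₁ f₂ : MvPolynomial (Fin 3) ℂ) (c₁ c₂ : ℕ)
    (hc₁ : 1 ≤ c₁) (hc₂ : 1 ≤ c₂)
    (hf₁ : f₁.IsHomogeneous c₁) (hf₂ : f₂.IsHomogeneous c₂)
    (htrans : ∀ p : Fin 3 → ℂ, p ≠ 0 → eval p f₁ = 0 → eval p f₂ = 0 →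
      LinearIndependent ℂ
        ![(fun i : Fin 3 => eval p (pderiv i f₁)),
          (fun i : Fin 3 => eval p (pderiv i f₂))])
    (G : MvPolynomial (Fin 3) ℂ) (N : ℕ) (hG : G.IsHomogeneous N)
    (hvan : ∀ p : Fin 3 → ℂ, eval p f₁ = 0 → eval p f₂ = 0 → eval p G = 0) :
    G ∈ Ideal.span {f₁, f₂} := by
  refine mem_span_pair_of_locally (isRelPrime_of_linearIndependent_pderiv htrans) fun p hp => ?_
  have hmem₁ : f₁ ∈ Ideal.span {f₁, f₂} := Ideal.subset_span (by simp)
  have hmem₂ : f₂ ∈ Ideal.span {f₁, f₂} := Ideal.subset_span (by simp)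
  by_cases h₁ : eval p f₁ = 0
  swap
  · exact ⟨f₁, h₁, Ideal.mul_mem_right _ _ hmem₁⟩
  by_cases h₂ : eval p f₂ = 0
  swap
  · exact ⟨f₂, h₂, Ideal.mul_mem_right _ _ hmem₂⟩
  obtain ⟨i, hpi⟩ := Function.ne_iff.1 hp
  have cone {f : MvPolynomial (Fin 3) ℂ} {c : ℕ} (hf : f.IsHomogeneous c) (h : eval p f = 0)
      (t : ℂ) : eval (t • p) f = 0 := by
    rw [hf.eval_smul_eq_pow_mul, h, mul_zero]
  refine exists_eval_ne_zero_mul_mem hpi (fun g hg t => ?_)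
    (pointIdeal_le_of_linearIndependent hf₁ hf₂ h₁ h₂ (htrans p hp h₁ h₂) hpi)
    fun t => hvan _ (cone hf₁ h₁ t) (cone hf₂ h₂ t)
  obtain ⟨a, b, rfl⟩ := Ideal.mem_span_pair.1 hg
  simp [cone hf₁ h₁ t, cone hf₂ h₂ t]
end

section
/- Let f₁, f₂ be homogeneous polynomials in ℂ[x,y,z] of degrees c₁ ≥ 1 and c₂ ≥ 1 such that for every p ∈ ℂ³ with p ≠ 0 and f₁(p) = f₂(p) = 0, the gradients of f₁ and f₂ at p are linearly independent over ℂ. Let H₁, H₂ ∈ ℂ[x,y,z] be homogeneous of the same degree N with H₁(p) = H₂(p) for every p ∈ ℂ³ with f₁(p) = f₂(p) = 0. Then there exists a homogeneous polynomial H of degree N such that H − H₁ belongs to the ideal generated by f₁ and H − H₂ belongs to the ideal generated by f₂ (so H agrees with H₁ on the curve f₁ = 0 and with H₂ on the curve f₂ = 0). -/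
open MvPolynomial

namespace TransversalGluing

section Algebra

variable {K : Type*} [Field K]

lemma X_dvd_of_X_mul_eq {i j : Fin 3} (hij : i ≠ j) {a b : MvPolynomial (Fin 3) K}
    (h : X j * a = X i * b) : X i ∣ a := by
  have hdvd : (X i : MvPolynomial (Fin 3) K) ∣ X j * a := ⟨b, h⟩
  rcases (X_prime (R := K) (i := i)).dvd_or_dvd hdvd with h' | h'
  · exact absurd (X_dvd_X.mp h') hij
  · exact h'

lemma mem_span_pair_of_X_mul_mem {d : MvPolynomial (Fin 3) K}
    (h : X 2 * d ∈ Ideal.span {(X 0 : MvPolynomial (Fin 3) K), X 1}) :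
    d ∈ Ideal.span {(X 0 : MvPolynomial (Fin 3) K), X 1} := by
  rw [← Set.image_pair, mem_ideal_span_X_image] at h ⊢
  intro m hm
  obtain ⟨i, hi, hne⟩ := h (Finsupp.single 2 1 + m) (by
    rw [mem_support_iff, coeff_X_mul]
    exact mem_support_iff.mp hm)
  refine ⟨i, hi, ?_⟩
  rcases hi with rfl | rfl <;> simpa using hne

/-- The irrelevant ideal of `K[x, y, z]` is not associated to a complete intersection of
two hypersurfaces. -/
lemma mem_span_pair_of_forall_X_mul_mem {f g a : MvPolynomial (Fin 3) K} (hf : f ≠ 0)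
    (hfg : IsRelPrime f g) (ha : ∀ i, X i * a ∈ Ideal.span {f, g}) :
    a ∈ Ideal.span {f, g} := by
  have hex : ∀ i, ∃ b c, b * f + c * g = X i * a := fun i => Ideal.mem_span_pair.mp (ha i)
  choose b c hbc using hex
  have hdvd : ∀ i j, f ∣ X j * c i - X i * c j := fun i j =>
    hfg.dvd_of_dvd_mul_right (z := g)
      ⟨X i * b j - X j * b i, by linear_combination X j * hbc i - X i * hbc j⟩
  obtain ⟨d, hd⟩ := hdvd 0 1
  obtain ⟨d', hd'⟩ := hdvd 0 2
  obtain ⟨d'', hd''⟩ := hdvd 1 2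
  have hkoszul : X 2 * d - X 1 * d' + X 0 * d'' = 0 := by
    apply mul_left_cancel₀ hf
    linear_combination X 1 * hd' - X 2 * hd - X 0 * hd''
  obtain ⟨p, q, hpq⟩ := Ideal.mem_span_pair.mp (mem_span_pair_of_X_mul_mem (d := d)
    (Ideal.mem_span_pair.mpr ⟨-d'', d', by linear_combination -hkoszul⟩))
  obtain ⟨u, hu⟩ := X_dvd_of_X_mul_eq (i := 0) (j := 1) (by decide)
    (a := c 0 - f * q) (b := c 1 + f * p) (by linear_combination hd - f * hpq)
  have hu' : c 1 + f * p = X 1 * u := by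
    apply mul_left_cancel₀ (X_ne_zero (R := K) (0 : Fin 3))
    linear_combination X 1 * hu - hd + f * hpq
  obtain ⟨v, hv⟩ := X_dvd_of_X_mul_eq (i := 0) (j := 1) (by decide)
    (a := b 0 + q * g) (b := b 1 - p * g) (by
      apply mul_left_cancel₀ hf
      linear_combination X 1 * hbc 0 - X 0 * hbc 1 - X 1 * g * hu + X 0 * g * hu')
  refine Ideal.mem_span_pair.mpr ⟨v, u, ?_⟩
  apply mul_left_cancel₀ (X_ne_zero (R := K) (0 : Fin 3))
  linear_combination hbc 0 - g * hu - f * hv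

lemma mem_span_pair_of_pow_idealOfVars {f g : MvPolynomial (Fin 3) K} (hf : f ≠ 0)
    (hfg : IsRelPrime f g) (k : ℕ) {a : MvPolynomial (Fin 3) K}
    (ha : ∀ s ∈ idealOfVars (Fin 3) K ^ k, s * a ∈ Ideal.span {f, g}) :
    a ∈ Ideal.span {f, g} := by
  induction k generalizing a with
  | zero => simpa using ha 1 (by simp)
  | succ k ih =>
    refine mem_span_pair_of_forall_X_mul_mem hf hfg fun i => ih fun s hs => ?_
    rw [← mul_assoc]
    exact ha _ (by
      rw [pow_succ]
      exact Ideal.mul_mem_mul hs (Ideal.subset_span ⟨i, rfl⟩))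

lemma eval_smul_of_isHomogeneous {σ : Type*} [Fintype σ] {f : MvPolynomial σ K} {n : ℕ}
    (hf : f.IsHomogeneous n) (t : K) (p : σ → K) : eval (t • p) f = t ^ n * eval p f := by
  rw [eval_eq', eval_eq', Finset.mul_sum]
  refine Finset.sum_congr rfl fun d hd => ?_
  have hdeg : ∑ i, d i = n := by
    simp [← hf (mem_support_iff.mp hd), Finsupp.weight_apply, Finsupp.sum_fintype]
  simp only [Pi.smul_apply, smul_eq_mul, mul_pow, Finset.prod_mul_distrib,
    Finset.prod_pow_eq_pow_sum, hdeg]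
  ring

lemma mem_of_eval_smul_eq_zero [Infinite K] {σ : Type*} {p : σ → K} {i : σ} (hp : p i ≠ 0)
    {J : Ideal (MvPolynomial σ K)} (hJ : ∀ j, C (p i) * X j - C (p j) * X i ∈ J)
    {q : MvPolynomial σ K} (hq : ∀ t : K, eval (t • p) q = 0) : q ∈ J := by
  have hzero : aeval (fun j => Polynomial.C (p j) * Polynomial.X) q = (0 : Polynomial K) := by
    refine Polynomial.funext fun t => ?_
    have h : (Polynomial.aeval t).comp (aeval fun j => Polynomial.C (p j) * Polynomial.X) =
        aeval (R := K) (t • p) := MvPolynomial.algHom_ext fun j => by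
      simp only [AlgHom.comp_apply, aeval_X, map_mul, Polynomial.aeval_C, Polynomial.aeval_X,
        Pi.smul_apply, smul_eq_mul, Algebra.algebraMap_self, RingHom.id_apply]
      ring
    have h' := DFunLike.congr_fun h q
    simpa [aeval_eq_eval, Polynomial.aeval_def, Polynomial.eval₂_id, hq t] using h'
  have hcomp : (Ideal.Quotient.mkₐ K J) =
      (Polynomial.aeval (Ideal.Quotient.mkₐ K J (C (p i)⁻¹ * X i))).comp
        (aeval fun j => Polynomial.C (p j) * Polynomial.X) := by
    refine MvPolynomial.algHom_ext fun j => ?_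
    have h : (C (p i)⁻¹ : MvPolynomial σ K) * C (p i) = 1 := by
      rw [← C_mul, inv_mul_cancel₀ hp, C_1]
    have hC : (algebraMap K (MvPolynomial σ K ⧸ J)) (p j) = Ideal.Quotient.mk J (C (p j)) := rfl
    simp only [AlgHom.comp_apply, aeval_X, map_mul, Polynomial.aeval_C, Polynomial.aeval_X,
      Ideal.Quotient.mkₐ_eq_mk]
    rw [hC, ← map_mul, ← map_mul, Ideal.Quotient.eq]
    convert J.mul_mem_left (C (p i)⁻¹) (hJ j) using 1
    linear_combination -(X j) * h
  rw [← Ideal.Quotient.eq_zero_iff_mem, ← Ideal.Quotient.mkₐ_eq_mk K, hcomp, AlgHom.comp_apply,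
    hzero, map_zero]

/-- The ideal of the line spanned by a nonzero point of `K³` is contained in an ideal generated by
two polynomials vanishing at that point. -/
lemma exists_pair_of_ne_zero [Infinite K] {p : Fin 3 → K} (hp : p ≠ 0) :
    ∃ l m : MvPolynomial (Fin 3) K, eval p l = 0 ∧ eval p m = 0 ∧
      ∀ q : MvPolynomial (Fin 3) K, (∀ t : K, eval (t • p) q = 0) → q ∈ Ideal.span {l, m} := by
  obtain ⟨i, hi⟩ := Function.ne_iff.mp hp
  have key : ∀ j k : Fin 3, (∀ n, n = i ∨ n = j ∨ n = k) →
      ∃ l m : MvPolynomial (Fin 3) K, eval p l = 0 ∧ eval p m = 0 ∧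
      ∀ q : MvPolynomial (Fin 3) K, (∀ t : K, eval (t • p) q = 0) → q ∈ Ideal.span {l, m} := by
    intro j k hjk
    refine ⟨C (p i) * X j - C (p j) * X i, C (p i) * X k - C (p k) * X i,
      by simp [mul_comm], by simp [mul_comm], fun q hq => mem_of_eval_smul_eq_zero hi ?_ hq⟩
    intro n
    rcases hjk n with rfl | rfl | rfl
    · simp
    · exact Ideal.subset_span (by simp)
    · exact Ideal.subset_span (by simp)
  have hcover : ∀ i n : Fin 3, n = i ∨ n = i + 1 ∨ n = i + 2 := by decide
  exact key (i + 1) (i + 2) (hcover i)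

lemma eval_pderiv_mul_of_eval_eq_zero {σ : Type*} {p : σ → K} {l : MvPolynomial σ K}
    (hl : eval p l = 0) (a : MvPolynomial σ K) (i : σ) :
    eval p (pderiv i (a * l)) = eval p a * eval p (pderiv i l) := by
  simp [Derivation.leibniz, hl]

/-- Local form of the radicality of a transversal intersection: near a point where the gradients
are independent, everything vanishing on the line through the point lies in the ideal. -/
lemma exists_eval_ne_zero_mul_mem [Infinite K] {f g h : MvPolynomial (Fin 3) K}
    {p : Fin 3 → K} (hp : p ≠ 0)
    (hind : LinearIndependent K
      ![(fun i : Fin 3 => eval p (pderiv i f)), (fun i : Fin 3 => eval p (pderiv i g))])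
    (hf : ∀ t : K, eval (t • p) f = 0) (hg : ∀ t : K, eval (t • p) g = 0)
    (hh : ∀ t : K, eval (t • p) h = 0) :
    ∃ s, eval p s ≠ 0 ∧ s * h ∈ Ideal.span {f, g} := by
  obtain ⟨l, m, hl, hm, hlm⟩ := exists_pair_of_ne_zero hp
  obtain ⟨a, b, rfl⟩ := Ideal.mem_span_pair.mp (hlm f hf)
  obtain ⟨c, d, rfl⟩ := Ideal.mem_span_pair.mp (hlm g hg)
  obtain ⟨u, v, rfl⟩ := Ideal.mem_span_pair.mp (hlm h hh)
  refine ⟨a * d - b * c, fun hdet => ?_, Ideal.mem_span_pair.mpr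
    ⟨u * d - v * c, v * a - u * b, by ring⟩⟩
  simp only [map_sub, map_mul] at hdet
  simp only [map_add, eval_pderiv_mul_of_eval_eq_zero hl, eval_pderiv_mul_of_eval_eq_zero hm]
    at hind
  rw [LinearIndependent.pair_iff] at hind
  obtain ⟨hd, hb⟩ := hind (eval p d) (-eval p b) (by
    ext i
    simp only [Pi.add_apply, Pi.smul_apply, smul_eq_mul, Pi.zero_apply]
    linear_combination eval p (pderiv i l) * hdet)
  obtain ⟨hc, ha⟩ := hind (-eval p c) (eval p a) (by
    ext i
    simp only [Pi.add_apply, Pi.smul_apply, smul_eq_mul, Pi.zero_apply]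
    linear_combination eval p (pderiv i m) * hdet)
  rw [neg_eq_zero] at hb
  exact one_ne_zero (hind 1 0 (by
    ext i
    simp [ha, hb])).1

end Algebra

lemma X_mem_radical {K : Type*} [Field K] [IsAlgClosed K] {σ : Type*} [Finite σ]
    {J : Ideal (MvPolynomial σ K)}
    (hJ : ∀ p : σ → K, p ≠ 0 → ∃ s ∈ J, eval p s ≠ 0) (i : σ) : X i ∈ J.radical := by
  rw [← vanishingIdeal_zeroLocus_eq_radical (K := K), mem_vanishingIdeal_iff]
  intro p hp
  by_cases h0 : p = 0
  · simp [h0]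
  · obtain ⟨s, hs, hne⟩ := hJ p h0
    exact absurd (by simpa [aeval_eq_eval] using hp s hs) hne

section Transversal

variable {K : Type*} [Field K] [IsAlgClosed K] {f g : MvPolynomial (Fin 3) K}

lemma isRelPrime_of_transversal
    (htrans : ∀ p : Fin 3 → K, p ≠ 0 → eval p f = 0 → eval p g = 0 →
      LinearIndependent K
        ![(fun i : Fin 3 => eval p (pderiv i f)), (fun i : Fin 3 => eval p (pderiv i g))]) :
    IsRelPrime f g := by
  refine WfDvdMonoid.isRelPrime_of_no_irreducible_factors ?_ ?_
  · rintro ⟨rfl, rfl⟩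
    have h := (htrans 1 one_ne_zero (map_zero _) (map_zero _)).ne_zero 0
    exact h (by ext i; simp)
  · rintro q hq ⟨a, rfl⟩ ⟨b, rfl⟩
    have hrad : ∀ i, X i ∈ (Ideal.span {q}).radical := X_mem_radical fun p hp => by
      refine ⟨q, Ideal.mem_span_singleton_self q, fun hqp => ?_⟩
      have hind := htrans p hp (by simp [hqp]) (by simp [hqp])
      simp only [mul_comm q, eval_pderiv_mul_of_eval_eq_zero hqp] at hind
      rw [LinearIndependent.pair_iff] at hind
      obtain ⟨-, ha⟩ := hind (eval p b) (-eval p a) (by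
        ext i
        simp only [Pi.add_apply, Pi.smul_apply, smul_eq_mul, Pi.zero_apply]
        ring)
      rw [neg_eq_zero] at ha
      exact one_ne_zero (hind 1 0 (by ext i; simp [ha])).1
    have hdvd : ∀ i, q ∣ X i := fun i => by
      obtain ⟨n, hn⟩ := hrad i
      exact hq.prime.dvd_of_dvd_pow (Ideal.mem_span_singleton.mp hn)
    have hassoc : X 0 ∣ q :=
      ((X_prime (R := K) (i := (0 : Fin 3))).irreducible.dvd_iff.mp (hdvd 0)).resolve_left
        hq.not_isUnit |>.dvd
    exact absurd (X_dvd_X.mp (hassoc.trans (hdvd 1))) (by decide)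

/-- Max Noether's theorem for transversal plane curves: a form vanishing on the intersection
lies in the ideal generated by the two equations. -/
lemma mem_span_pair_of_transversal {c₁ c₂ : ℕ} (hc₂ : 1 ≤ c₂)
    (hf : f.IsHomogeneous c₁) (hg : g.IsHomogeneous c₂)
    (htrans : ∀ p : Fin 3 → K, p ≠ 0 → eval p f = 0 → eval p g = 0 →
      LinearIndependent K
        ![(fun i : Fin 3 => eval p (pderiv i f)), (fun i : Fin 3 => eval p (pderiv i g))])
    {h : MvPolynomial (Fin 3) K} (hh : ∀ p, eval p f = 0 → eval p g = 0 → eval p h = 0) :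
    h ∈ Ideal.span {f, g} := by
  have hrel := isRelPrime_of_transversal htrans
  have hf0 : f ≠ 0 := by
    rintro rfl
    have h0 : eval 0 g = 0 := by
      simpa [zero_pow (Nat.one_le_iff_ne_zero.mp hc₂)] using
        eval_smul_of_isHomogeneous hg 0 (0 : Fin 3 → K)
    exact not_isUnit_zero (h0 ▸ (isRelPrime_zero_left.mp hrel).map (eval (0 : Fin 3 → K)))
  let J : Ideal (MvPolynomial (Fin 3) K) := (Ideal.span {f, g}).colon {h}
  have hJ : ∀ s, s ∈ J ↔ s * h ∈ Ideal.span {f, g} := fun s => by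
    simp [J, Submodule.mem_colon_singleton]
  have hrad : idealOfVars (Fin 3) K ≤ J.radical := by
    rw [idealOfVars, Ideal.span_le]
    rintro _ ⟨i, rfl⟩
    refine X_mem_radical (fun p hp => ?_) i
    by_cases hfp : eval p f = 0
    · by_cases hgp : eval p g = 0
      · have hft : ∀ t : K, eval (t • p) f = 0 := fun t => by
          rw [eval_smul_of_isHomogeneous hf, hfp, mul_zero]
        have hgt : ∀ t : K, eval (t • p) g = 0 := fun t => by
          rw [eval_smul_of_isHomogeneous hg, hgp, mul_zero]
        have : Infinite K := IsAlgClosed.instInfinite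
        obtain ⟨s, hs, hmem⟩ := exists_eval_ne_zero_mul_mem hp (htrans p hp hfp hgp) hft hgt
          fun t => hh _ (hft t) (hgt t)
        exact ⟨s, (hJ s).mpr hmem, hs⟩
      · exact ⟨g, (hJ g).mpr (Ideal.mul_mem_right _ _ (Ideal.subset_span (by simp))), hgp⟩
    · exact ⟨f, (hJ f).mpr (Ideal.mul_mem_right _ _ (Ideal.subset_span (by simp))), hfp⟩
  obtain ⟨k, hk⟩ := Ideal.exists_pow_le_of_le_radical_of_fg hrad (idealOfVars_fg _ _)
  exact mem_span_pair_of_pow_idealOfVars hf0 hrel k fun s hs => (hJ s).mp (hk hs)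

end Transversal

attribute [local instance] MvPolynomial.gradedAlgebra in
lemma homogeneousComponent_mem_span_singleton {σ R : Type*} [CommRing R]
    {f q : MvPolynomial σ R} {c : ℕ} (hf : f.IsHomogeneous c) (hq : q ∈ Ideal.span {f}) (n : ℕ) :
    homogeneousComponent n q ∈ Ideal.span {f} :=
  homogeneousComponent_mem_of_mem
    (Ideal.homogeneous_span _ _ (by rintro _ rfl; exact ⟨c, hf⟩)) hq n

end TransversalGluing

open TransversalGluing in
/-- Gluing statement from the induction step of the proof of Corollary 2.5:
two forms of the same degree agreeing on the transversal intersection of two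
plane curves can be glued to a single form agreeing with each on the
corresponding curve. -/
theorem stmt_3 (f₁ f₂ : MvPolynomial (Fin 3) ℂ) (c₁ c₂ : ℕ)
    (hc₁ : 1 ≤ c₁) (hc₂ : 1 ≤ c₂)
    (hf₁ : f₁.IsHomogeneous c₁) (hf₂ : f₂.IsHomogeneous c₂)
    (htrans : ∀ p : Fin 3 → ℂ, p ≠ 0 → eval p f₁ = 0 → eval p f₂ = 0 →
      LinearIndependent ℂ
        ![(fun i : Fin 3 => eval p (pderiv i f₁)),
          (fun i : Fin 3 => eval p (pderiv i f₂))])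
    (H₁ H₂ : MvPolynomial (Fin 3) ℂ) (N : ℕ)
    (hH₁ : H₁.IsHomogeneous N) (hH₂ : H₂.IsHomogeneous N)
    (hagree : ∀ p : Fin 3 → ℂ, eval p f₁ = 0 → eval p f₂ = 0 →
      eval p H₁ = eval p H₂) :
    ∃ H : MvPolynomial (Fin 3) ℂ, H.IsHomogeneous N ∧
      H - H₁ ∈ Ideal.span {f₁} ∧ H - H₂ ∈ Ideal.span {f₂} := by
  obtain ⟨a, b, hab⟩ := Ideal.mem_span_pair.mp
    (mem_span_pair_of_transversal hc₂ hf₁ hf₂ htrans (h := H₁ - H₂)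
      fun p h₁ h₂ => by rw [map_sub, hagree p h₁ h₂, sub_self])
  refine ⟨homogeneousComponent N (H₁ - a * f₁), homogeneousComponent_isHomogeneous _ _, ?_, ?_⟩
  · convert homogeneousComponent_mem_span_singleton hf₁
      (Ideal.mem_span_singleton'.mpr ⟨-a, rfl⟩) N using 1
    nth_rw 2 [← homogeneousComponent_eq_self hH₁]
    rw [← map_sub]
    congr 1
    ring
  · convert homogeneousComponent_mem_span_singleton hf₂
      (Ideal.mem_span_singleton'.mpr ⟨b, rfl⟩) N using 1
    nth_rw 1 [← homogeneousComponent_eq_self hH₂]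
    rw [← map_sub]
    congr 1
    linear_combination -hab
end

section
/- Let μ ≥ 2 be an integer, ζ ∈ ℂ a primitive 2μ-th root of unity, and j₁, j₂, j₃, d integers with d ≥ 0. Define parametrizations φ₁(s,t) = (s, ζ^{2j₁−1}s, t), φ₂(s,t) = (t, s, ζ^{2j₂−1}s), φ₃(s,t) = (ζ^{2j₃−1}s, t, s) of the lines L^μ_{1,j₁}: ζ^{2j₁−1}x − y = 0, L^μ_{2,j₂}: ζ^{2j₂−1}y − z = 0, L^μ_{3,j₃}: ζ^{2j₃−1}z − x = 0. Then the following are equivalent: (i) there exist a homogeneous polynomial G ∈ ℂ[x,y,z] of degree d and nonzero constants c₁, c₂, c₃ ∈ ℂ such that G(φ_i(s,t)) = c_i t^d as polynomials in s, t for each i = 1, 2, 3; (ii) (ζ^{2j₁+2j₂+2j₃−3})^{2d} = 1. -/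
open MvPolynomial

/-- Evaluating after substituting polynomials is evaluating at the substituted values. -/
theorem eval_aeval_vec_three {K τ : Type*} [CommRing K] (p : τ → K) (x y z : MvPolynomial τ K)
    (G : MvPolynomial (Fin 3) K) :
    eval p (aeval ![x, y, z] G) = eval ![eval p x, eval p y, eval p z] G := by
  induction G using MvPolynomial.induction_on with
  | C a => simp [algebraMap_eq]
  | add f g hf hg => rw [map_add, map_add, map_add, hf, hg]
  | mul_X f i hf =>
    rw [map_mul, map_mul, map_mul, hf, aeval_X, eval_X]
    fin_cases i <;> rfl

/-- The necessary condition in Carnot's theorem for three lines `y = a x`, `z = b y`, `x = c z`: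
compare the values of the form at the three intersection points. -/
theorem mul_pow_eq_one_of_restrictions {K : Type*} [Field K] {a b c c₁ c₂ c₃ : K} {d : ℕ}
    (h₁ : c₁ ≠ 0) {G : MvPolynomial (Fin 3) K}
    (e₁ : aeval ![(X 0 : MvPolynomial (Fin 2) K), C a * X 0, X 1] G = C c₁ * X 1 ^ d)
    (e₂ : aeval ![(X 1 : MvPolynomial (Fin 2) K), X 0, C b * X 0] G = C c₂ * X 1 ^ d)
    (e₃ : aeval ![C c * (X 0 : MvPolynomial (Fin 2) K), X 1, X 0] G = C c₃ * X 1 ^ d) :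
    (a * b * c) ^ (2 * d) = 1 := by
  have v₁ (s t : K) : eval ![s, a * s, t] G = c₁ * t ^ d := by
    have h := congrArg (eval ![s, t]) e₁
    simpa only [eval_aeval_vec_three, map_mul, map_pow, eval_X, eval_C, Matrix.cons_val] using h
  have v₂ (s t : K) : eval ![t, s, b * s] G = c₂ * t ^ d := by
    have h := congrArg (eval ![s, t]) e₂
    simpa only [eval_aeval_vec_three, map_mul, map_pow, eval_X, eval_C, Matrix.cons_val] using h
  have v₃ (s t : K) : eval ![c * s, t, s] G = c₃ * t ^ d := by
    have h := congrArg (eval ![s, t]) e₃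
    simpa only [eval_aeval_vec_three, map_mul, map_pow, eval_X, eval_C, Matrix.cons_val] using h
  have p₁₂ : c₂ = c₁ * (b * a) ^ d := by
    have h := v₁ 1 (b * a)
    have h' := v₂ a 1
    simp only [mul_one, one_pow] at h h'
    exact h'.symm.trans h
  have p₂₃ : c₃ = c₂ * (c * b) ^ d := by
    have h := v₂ 1 (c * b)
    have h' := v₃ b 1
    simp only [mul_one, one_pow] at h h'
    exact h'.symm.trans h
  have p₃₁ : c₁ = c₃ * (a * c) ^ d := by
    have h := v₃ 1 (a * c)
    have h' := v₁ c 1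
    simp only [mul_one, one_pow] at h h'
    exact h'.symm.trans h
  apply mul_left_cancel₀ h₁
  rw [mul_one]
  conv_rhs => rw [p₃₁, p₂₃, p₁₂]
  rw [pow_mul, mul_assoc c₁, mul_assoc c₁, ← mul_pow, ← mul_pow]
  ring

/-- The sufficient condition in Carnot's theorem for three non-concurrent lines
`y = a x`, `z = b y`, `x = c z`. -/
theorem exists_form_of_mul_pow_eq_one {K : Type*} [Field K] {a b c : K} {d : ℕ}
    (ha : a ≠ 0) (hb : b ≠ 0) (hc : c ≠ 0) (habc : a * b * c ≠ 1)
    (h : (a * b * c) ^ (2 * d) = 1) :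
    ∃ (G : MvPolynomial (Fin 3) K) (c₁ c₂ c₃ : K),
      G.IsHomogeneous d ∧ c₁ ≠ 0 ∧ c₂ ≠ 0 ∧ c₃ ≠ 0 ∧
      aeval ![(X 0 : MvPolynomial (Fin 2) K), C a * X 0, X 1] G = C c₁ * X 1 ^ d ∧
      aeval ![(X 1 : MvPolynomial (Fin 2) K), X 0, C b * X 0] G = C c₂ * X 1 ^ d ∧
      aeval ![C c * (X 0 : MvPolynomial (Fin 2) K), X 1, X 0] G = C c₃ * X 1 ^ d := by
  rcases Nat.eq_zero_or_pos d with rfl | hd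
  · exact ⟨1, 1, 1, 1, isHomogeneous_one _ _, by simp⟩
  have hk : a * b * c - 1 ≠ 0 := sub_ne_zero.mpr habc
  have hd' : d ≠ 0 := hd.ne'
  obtain ⟨m, hm⟩ : ∃ m, m = (a * b) ^ d := ⟨_, rfl⟩
  obtain ⟨n, hn⟩ : ∃ n, n = (a * b) ^ d * (b * c) ^ d := ⟨_, rfl⟩
  have hmn : n = m * (b * c) ^ d := by rw [hn, hm]
  have hn1 : n * (a * c) ^ d = 1 := by
    rw [hn, ← mul_pow, ← mul_pow, ← h, pow_mul]
    ring
  let u : MvPolynomial (Fin 3) K := C a * X 0 - X 1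
  let v : MvPolynomial (Fin 3) K := C b * X 1 - X 2
  let w : MvPolynomial (Fin 3) K := C c * X 2 - X 0
  have hX (r : K) (i j : Fin 3) :
      (C r * X i - X j : MvPolynomial (Fin 3) K).IsHomogeneous 1 :=
    ((isHomogeneous_X _ _).C_mul r).sub (isHomogeneous_X _ _)
  have hlin {p q : MvPolynomial (Fin 3) K} (hp : p.IsHomogeneous 1) (hq : q.IsHomogeneous 1)
      (r : K) : ((p + C r * q) ^ d).IsHomogeneous d := by
    simpa using (hp.add (hq.C_mul r)).pow d
  have hpow {p : MvPolynomial (Fin 3) K} (hp : p.IsHomogeneous 1) :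
      (p ^ d).IsHomogeneous d := by
    simpa using hp.pow d
  have hu : u.IsHomogeneous 1 := hX _ _ _
  have hv : v.IsHomogeneous 1 := hX _ _ _
  have hw : w.IsHomogeneous 1 := hX _ _ _
  have em : (C m : MvPolynomial (Fin 2) K) = (C a * C b) ^ d := by rw [hm]; simp
  have en : (C n : MvPolynomial (Fin 2) K) = C m * (C b * C c) ^ d := by rw [hmn]; simp
  have e1 : (C n : MvPolynomial (Fin 2) K) * (C a * C c) ^ d = 1 := by
    rw [← C_mul, ← C_pow, ← C_mul, hn1, C_1]
  refine ⟨(v + C (a * b) * w) ^ d + C m * (w + C (b * c) * u) ^ d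
      + C n * (u + C (a * c) * v) ^ d - C n * u ^ d - v ^ d - C m * w ^ d,
    (a * b * c - 1) ^ d, m * (a * b * c - 1) ^ d, n * (a * b * c - 1) ^ d, ?_,
    pow_ne_zero _ hk, ?_, ?_, ?_, ?_, ?_⟩
  · exact ((((hlin hv hw _).add ((hlin hw hu _).C_mul _)).add ((hlin hu hv _).C_mul _)).sub
      ((hpow hu).C_mul _)).sub (hpow hv) |>.sub ((hpow hw).C_mul _)
  · rw [hm]; positivity
  · rw [hn]; positivity
  · simp only [u, v, w, map_sub, map_add, map_mul, map_pow, aeval_X, aeval_C, algebraMap_eq,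
      Matrix.cons_val, C_1, sub_self, mul_zero, add_zero, zero_add, zero_pow hd']
    rw [show (C b * (C a * X 0) - X 1 + C a * C b * (C c * X 1 - X 0) : MvPolynomial (Fin 2) K)
      = (C a * C b * C c - 1) * X 1 by ring, mul_pow, mul_pow (C a * C c)]
    linear_combination (C b * (C a * X 0) - X 1) ^ d * e1
  · simp only [u, v, w, map_sub, map_add, map_mul, map_pow, aeval_X, aeval_C, algebraMap_eq,
      Matrix.cons_val, C_1, sub_self, mul_zero, add_zero, zero_add, zero_pow hd']
    rw [show (C c * (C b * X 0) - X 1 + C b * C c * (C a * X 1 - X 0) : MvPolynomial (Fin 2) K)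
      = (C a * C b * C c - 1) * X 1 by ring, mul_pow (C a * C b * C c - 1), mul_pow (C a * C b)]
    linear_combination -(C c * (C b * X 0) - X 1) ^ d * em
  · simp only [u, v, w, map_sub, map_add, map_mul, map_pow, aeval_X, aeval_C, algebraMap_eq,
      Matrix.cons_val, C_1, sub_self, mul_zero, add_zero, zero_add, zero_pow hd']
    rw [show (C a * (C c * X 0) - X 1 + C a * C c * (C b * X 1 - X 0) : MvPolynomial (Fin 2) K)
      = (C a * C b * C c - 1) * X 1 by ring, mul_pow (C a * C b * C c - 1), mul_pow (C b * C c)]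
    linear_combination -(C a * (C c * X 0) - X 1) ^ d * en

/-- Lemma 4.3 (Carnot's theorem, cf. Coppens–Kato) for the tangent lines of
the Fermat curve at its total inflection points. -/
theorem stmt_4 (μ : ℕ) (hμ : 2 ≤ μ) (ζ : ℂ) (hζ : IsPrimitiveRoot ζ (2 * μ))
    (j₁ j₂ j₃ : ℤ) (d : ℕ) :
    (∃ (G : MvPolynomial (Fin 3) ℂ) (c₁ c₂ c₃ : ℂ),
        G.IsHomogeneous d ∧ c₁ ≠ 0 ∧ c₂ ≠ 0 ∧ c₃ ≠ 0 ∧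
        aeval ![(X 0 : MvPolynomial (Fin 2) ℂ),
            C (ζ ^ (2 * j₁ - 1)) * X 0, X 1] G = C c₁ * X 1 ^ d ∧
        aeval ![(X 1 : MvPolynomial (Fin 2) ℂ),
            X 0, C (ζ ^ (2 * j₂ - 1)) * X 0] G = C c₂ * X 1 ^ d ∧
        aeval ![C (ζ ^ (2 * j₃ - 1)) * (X 0 : MvPolynomial (Fin 2) ℂ),
            X 1, X 0] G = C c₃ * X 1 ^ d) ↔
      (ζ ^ (2 * j₁ + 2 * j₂ + 2 * j₃ - 3)) ^ (2 * d) = 1 := by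
  have h0 : ζ ≠ 0 := hζ.ne_zero (by omega)
  have hprod : ζ ^ (2 * j₁ + 2 * j₂ + 2 * j₃ - 3)
      = ζ ^ (2 * j₁ - 1) * ζ ^ (2 * j₂ - 1) * ζ ^ (2 * j₃ - 1) := by
    rw [← zpow_add₀ h0, ← zpow_add₀ h0]
    congr 1
    ring
  constructor
  · rintro ⟨G, c₁, c₂, c₃, -, h₁, -, -, e₁, e₂, e₃⟩
    rw [hprod]
    exact mul_pow_eq_one_of_restrictions h₁ e₁ e₂ e₃
  · intro h
    rw [hprod] at h
    refine exists_form_of_mul_pow_eq_one (zpow_ne_zero _ h0) (zpow_ne_zero _ h0)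
      (zpow_ne_zero _ h0) ?_ h
    rw [← hprod, Ne, hζ.zpow_eq_one_iff_dvd]
    rintro ⟨k, hk⟩
    push_cast at hk
    rw [mul_assoc] at hk
    omega
end

section
/- Let μ ≥ 2 be an integer, ζ ∈ ℂ a primitive 2μ-th root of unity, and d ≥ 0 an integer. Define φ₁(s,t) = (s, ζs, t), φ₂(s,t) = (t, s, ζs), φ₃(s,t) = (ζ^{2μ−1}s, t, s). Then there exist a homogeneous polynomial G ∈ ℂ[x,y,z] of degree d and nonzero constants c₁, c₂, c₃ ∈ ℂ with G(φ_i(s,t)) = c_i t^d as polynomials in s, t for i = 1, 2, 3 if and only if μ divides d. -/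
open MvPolynomial

theorem MvPolynomial.eval_aeval {R σ τ : Type*} [CommSemiring R] (v : τ → R)
    (f : σ → MvPolynomial τ R) (p : MvPolynomial σ R) :
    eval v (aeval f p) = eval (fun i => eval v (f i)) p := by
  induction p using MvPolynomial.induction_on with
  | C a => simp
  | add p q hp hq => simp only [map_add, hp, hq]
  | mul_X p i hp => simp only [map_mul, hp, aeval_X, eval_X]

theorem IsPrimitiveRoot.pow_eq_neg_one {R : Type*} [CommRing R] [IsDomain R] {ζ : R} {m : ℕ}
    (hm : 0 < m) (hζ : IsPrimitiveRoot ζ (2 * m)) : ζ ^ m = -1 :=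
  (hζ.pow (by positivity) (mul_comm 2 m)).eq_neg_one_of_two_right

/-- Specialization of Lemma 4.3 (Carnot's theorem) to the inflection points
`P^μ_{1,1}`, `P^μ_{2,1}`, `P^μ_{3,μ}` of the Fermat curve: the Carnot
condition holds exactly when `μ ∣ d`. -/
theorem stmt_5 (μ : ℕ) (hμ : 2 ≤ μ) (ζ : ℂ) (hζ : IsPrimitiveRoot ζ (2 * μ))
    (d : ℕ) :
    (∃ (G : MvPolynomial (Fin 3) ℂ) (c₁ c₂ c₃ : ℂ),
        G.IsHomogeneous d ∧ c₁ ≠ 0 ∧ c₂ ≠ 0 ∧ c₃ ≠ 0 ∧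
        aeval ![(X 0 : MvPolynomial (Fin 2) ℂ), C ζ * X 0, X 1] G
          = C c₁ * X 1 ^ d ∧
        aeval ![(X 1 : MvPolynomial (Fin 2) ℂ), X 0, C ζ * X 0] G
          = C c₂ * X 1 ^ d ∧
        aeval ![C (ζ ^ (2 * μ - 1)) * (X 0 : MvPolynomial (Fin 2) ℂ), X 1, X 0] G
          = C c₃ * X 1 ^ d) ↔
      μ ∣ d := by
  have hinv : ζ ^ (2 * μ - 1) * ζ = 1 := by
    rw [← pow_succ, Nat.sub_add_cancel (by omega), hζ.pow_eq_one]
  constructor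
  · rintro ⟨G, c₁, c₂, c₃, -, hc₁, -, -, h₁, h₂, h₃⟩
    have e₁ (s t : ℂ) : eval ![s, ζ * s, t] G = c₁ * t ^ d := by
      have h := congrArg (eval ![s, t]) h₁
      rw [eval_aeval] at h
      convert h using 2
      · congr 1; ext i; fin_cases i <;> simp
      · simp
    have e₂ (s t : ℂ) : eval ![t, s, ζ * s] G = c₂ * t ^ d := by
      have h := congrArg (eval ![s, t]) h₂
      rw [eval_aeval] at h
      convert h using 2
      · congr 1; ext i; fin_cases i <;> simp
      · simp
    have e₃ (s t : ℂ) : eval ![ζ ^ (2 * μ - 1) * s, t, s] G = c₃ * t ^ d := by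
      have h := congrArg (eval ![s, t]) h₃
      rw [eval_aeval] at h
      convert h using 2
      · congr 1; ext i; fin_cases i <;> simp
      · simp
    have h₁₂ : c₁ * (ζ * ζ) ^ d = c₂ := by
      simpa using (e₁ 1 (ζ * ζ)).symm.trans (by simpa using e₂ ζ 1)
    have h₂₃ : c₂ = c₃ := by
      have h := e₃ ζ 1
      rw [hinv] at h
      simpa using (e₂ 1 1).symm.trans (by simpa using h)
    have h₃₁ : c₃ * ζ ^ d = c₁ * ζ ^ d := by
      have h := e₃ ζ ζ
      rw [hinv] at h
      exact h.symm.trans (by simpa using e₁ 1 ζ)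
    have hζd : ζ ^ d ≠ 0 := pow_ne_zero _ (hζ.ne_zero (by omega))
    have hc : c₃ = c₁ := mul_right_cancel₀ hζd h₃₁
    have hone : ζ ^ (2 * d) = 1 := by
      apply mul_left_cancel₀ hc₁
      rw [pow_mul, pow_two, h₁₂, h₂₃, hc, mul_one]
    exact Nat.dvd_of_mul_dvd_mul_left two_pos (hζ.dvd_of_pow_eq_one _ hone)
  · rintro ⟨k, rfl⟩
    have hneg : (C ζ : MvPolynomial (Fin 2) ℂ) ^ μ = -1 := by
      rw [← C_pow, hζ.pow_eq_neg_one (by omega), C_neg, C_1]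
    have hneg' : ((C ζ : MvPolynomial (Fin 2) ℂ) ^ (2 * μ - 1)) ^ μ = -1 := by
      have h := congrArg (fun z : ℂ => (C z : MvPolynomial (Fin 2) ℂ) ^ μ) hinv
      simp only [map_mul, map_pow, map_one, mul_pow, hneg, one_pow] at h
      linear_combination -h
    refine ⟨(X 0 ^ μ + X 1 ^ μ + X 2 ^ μ) ^ k, 1, 1, 1, ?_, one_ne_zero, one_ne_zero,
      one_ne_zero, ?_, ?_, ?_⟩
    · exact ((((isHomogeneous_X_pow 0 μ).add (isHomogeneous_X_pow 1 μ)).add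
        (isHomogeneous_X_pow 2 μ)).pow k)
    · simp [-aeval_eq_bind₁, mul_pow, hneg, pow_mul]
    · simp [-aeval_eq_bind₁, mul_pow, hneg, pow_mul]
    · simp [-aeval_eq_bind₁, mul_pow, hneg', pow_mul]
end

section
/- Let μ ≥ 2 and ν ≥ 1 be integers, b = μν with b ≥ 3, and ζ ∈ ℂ a primitive 2μ-th root of unity. Set h = x^μ + y^μ + z^μ, f₁ = ζx − y, f₂ = ζy − z, f₃ = ζ^{2μ−1}z − x, let g ∈ ℂ[x,y,z] be any homogeneous polynomial of degree b − 3, and set F = f₁f₂f₃·g + h^ν. Then as polynomials in s, t: F(s, ζs, t) = t^b, F(t, s, ζs) = t^b, and F(ζ^{2μ−1}s, t, s) = t^b. -/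
open MvPolynomial

/-- The restriction of the defining equation of `B_{b,μ}` to each of the three
tangent lines `L^μ_{1,1}`, `L^μ_{2,1}`, `L^μ_{3,μ}` is exactly `t^b`. -/
theorem stmt_8 (μ ν b : ℕ) (hμ : 2 ≤ μ) (hν : 1 ≤ ν) (hb : b = μ * ν)
    (hb3 : 3 ≤ b) (ζ : ℂ) (hζ : IsPrimitiveRoot ζ (2 * μ))
    (g : MvPolynomial (Fin 3) ℂ) (hg : g.IsHomogeneous (b - 3))
    (h f₁ f₂ f₃ F : MvPolynomial (Fin 3) ℂ)
    (hh : h = X 0 ^ μ + X 1 ^ μ + X 2 ^ μ)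
    (hf₁ : f₁ = C ζ * X 0 - X 1)
    (hf₂ : f₂ = C ζ * X 1 - X 2)
    (hf₃ : f₃ = C (ζ ^ (2 * μ - 1)) * X 2 - X 0)
    (hF : F = f₁ * f₂ * f₃ * g + h ^ ν) :
    aeval ![(X 0 : MvPolynomial (Fin 2) ℂ), C ζ * X 0, X 1] F = X 1 ^ b ∧
    aeval ![(X 1 : MvPolynomial (Fin 2) ℂ), X 0, C ζ * X 0] F = X 1 ^ b ∧
    aeval ![C (ζ ^ (2 * μ - 1)) * (X 0 : MvPolynomial (Fin 2) ℂ), X 1, X 0] F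
      = X 1 ^ b := by
  have hζμ : ζ ^ μ = -1 := (hζ.pow (by omega) (Nat.mul_comm 2 μ)).eq_neg_one_of_two_right
  have hC : (C ζ : MvPolynomial (Fin 2) ℂ) ^ μ = -1 := by
    rw [← C_pow, hζμ, C_neg, C_1]
  have hC' : ((C ζ : MvPolynomial (Fin 2) ℂ) ^ (2 * μ - 1)) ^ μ = -1 := by
    rw [pow_right_comm, hC]
    exact Odd.neg_one_pow ⟨μ - 1, by omega⟩
  subst hF hh hf₁ hf₂ hf₃ hb
  refine ⟨?_, ?_, ?_⟩ <;> simp [mul_pow, hC, hC', pow_mul]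
end

section
/- Let μ ≥ 2 and ν ≥ 1 be integers, b = μν with b ≥ 3, and ζ ∈ ℂ a primitive 2μ-th root of unity. Set h = x^μ + y^μ + z^μ, f₁ = ζx − y, f₂ = ζy − z, f₃ = ζ^{2μ−1}z − x, let g ∈ ℂ[x,y,z] be any homogeneous polynomial of degree b − 3, and set F = f₁f₂f₃·g + h^ν. Then: (1) every nonzero p ∈ ℂ³ with F(p) = 0 and f₁(p) = 0 is a scalar multiple of (1, ζ, 0); (2) every nonzero p ∈ ℂ³ with F(p) = 0 and f₂(p) = 0 is a scalar multiple of (0, 1, ζ); (3) every nonzero p ∈ ℂ³ with F(p) = 0 and f₃(p) = 0 is a scalar multiple of (ζ^{2μ−1}, 0, 1). -/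
open MvPolynomial

/-- The `μ`-th power of a primitive `2μ`-th root of unity is `-1`. -/
theorem IsPrimitiveRoot.pow_half_eq_neg_one {R : Type*} [CommRing R] [IsDomain R] {ζ : R} {μ : ℕ}
    (hμ : 0 < μ) (hζ : IsPrimitiveRoot ζ (2 * μ)) : ζ ^ μ = -1 :=
  (hζ.pow (by omega) (mul_comm 2 μ)).eq_neg_one_of_two_right

/-- Each of the three lines `f_{μ,i} = 0` meets the curve `B_{b,μ}` at a single
point, namely `P^μ_{1,1} = (1:ζ:0)`, `P^μ_{2,1} = (0:1:ζ)`,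
`P^μ_{3,μ} = (ζ^{2μ-1}:0:1)` respectively. -/
theorem stmt_9 (μ ν b : ℕ) (hμ : 2 ≤ μ) (hν : 1 ≤ ν) (hb : b = μ * ν)
    (hb3 : 3 ≤ b) (ζ : ℂ) (hζ : IsPrimitiveRoot ζ (2 * μ))
    (g : MvPolynomial (Fin 3) ℂ) (hg : g.IsHomogeneous (b - 3))
    (h f₁ f₂ f₃ F : MvPolynomial (Fin 3) ℂ)
    (hh : h = X 0 ^ μ + X 1 ^ μ + X 2 ^ μ)
    (hf₁ : f₁ = C ζ * X 0 - X 1)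
    (hf₂ : f₂ = C ζ * X 1 - X 2)
    (hf₃ : f₃ = C (ζ ^ (2 * μ - 1)) * X 2 - X 0)
    (hF : F = f₁ * f₂ * f₃ * g + h ^ ν) :
    (∀ p : Fin 3 → ℂ, p ≠ 0 → eval p F = 0 → eval p f₁ = 0 →
      ∃ c : ℂ, p = c • ![1, ζ, 0]) ∧
    (∀ p : Fin 3 → ℂ, p ≠ 0 → eval p F = 0 → eval p f₂ = 0 →
      ∃ c : ℂ, p = c • ![0, 1, ζ]) ∧
    (∀ p : Fin 3 → ℂ, p ≠ 0 → eval p F = 0 → eval p f₃ = 0 →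
      ∃ c : ℂ, p = c • ![ζ ^ (2 * μ - 1), 0, 1]) := by
  have hζμ : ζ ^ μ = -1 := hζ.pow_half_eq_neg_one (by omega)
  have hζμ' : (ζ ^ (2 * μ - 1)) ^ μ = -1 := by
    rw [← pow_mul, mul_comm, pow_mul, hζμ]
    exact Odd.neg_one_pow ⟨μ - 1, by omega⟩
  have key : ∀ p : Fin 3 → ℂ, eval p F = 0 → eval p (f₁ * f₂ * f₃) = 0 →
      p 0 ^ μ + p 1 ^ μ + p 2 ^ μ = 0 := by
    intro p hp hf
    rw [hF, map_add, map_mul, hf, zero_mul, zero_add, map_pow] at hp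
    simpa [hh] using eq_zero_of_pow_eq_zero hp
  refine ⟨fun p _ hp hf => ?_, fun p _ hp hf => ?_, fun p _ hp hf => ?_⟩
  · have hsum := key p hp (by simp [hf])
    have h1 : p 1 = ζ * p 0 := by
      simp only [hf₁, map_sub, map_mul, eval_C, eval_X] at hf
      linear_combination -hf
    rw [h1, mul_pow, hζμ] at hsum
    have h2 : p 2 = 0 := eq_zero_of_pow_eq_zero (n := μ) (by linear_combination hsum)
    refine ⟨p 0, ?_⟩
    ext i
    fin_cases i <;> simp [h1, h2, mul_comm]
  · have hsum := key p hp (by simp [hf])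
    have h2 : p 2 = ζ * p 1 := by
      simp only [hf₂, map_sub, map_mul, eval_C, eval_X] at hf
      linear_combination -hf
    rw [h2, mul_pow, hζμ] at hsum
    have h0 : p 0 = 0 := eq_zero_of_pow_eq_zero (n := μ) (by linear_combination hsum)
    refine ⟨p 1, ?_⟩
    ext i
    fin_cases i <;> simp [h0, h2, mul_comm]
  · have hsum := key p hp (by simp [hf])
    have h0 : p 0 = ζ ^ (2 * μ - 1) * p 2 := by
      simp only [hf₃, map_sub, map_mul, eval_C, eval_X] at hf
      linear_combination -hf
    rw [h0, mul_pow, hζμ'] at hsum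
    have h1 : p 1 = 0 := eq_zero_of_pow_eq_zero (n := μ) (by linear_combination hsum)
    refine ⟨p 2, ?_⟩
    ext i
    fin_cases i <;> simp [h0, h1, mul_comm]
end
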